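/- Let S be a quasi completely regular semiring with least b-lattice congruence ξ, and let a, b ∈ S lie in the same ξ-class. Then a 𝒴 b if and only if for all e, f, g, h ∈ E⁺(S) with e R*⁺ a, a L*⁺ f, g R*⁺ b and b L*⁺ h, one has a+0_a = e+b+0_b+f and b+0_b = g+a+0_a+h. -/

import Mathlib

/-- A "semiring" in the sense of the paper: both reducts are semigroups
(no commutativity, no identities) and multiplication distributes over
addition on both sides. -/
class PSemiring (S : Type*) extends AddSemigroup S, Semigroup S where
  left_distrib : ∀ a b c : S, a * (b + c) = a * b + a * c
  right_distrib : ∀ a b c : S, (a + b) * c = a * c + b * c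

namespace PSemiring

variable {S : Type*} [PSemiring S]

/-- `nmul n a` is the `(n+1)`-fold sum `a + ⋯ + a`; thus the positive
multiple `m·a` of the paper is `nmul (m-1) a`. -/
def nmul : ℕ → S → S
  | 0, a => a
  | n + 1, a => nmul n a + a

/-- `a` is additively regular. -/
def AddRegular (a : S) : Prop := ∃ x, a + x + a = a

/-- `a` is a completely regular element. -/
def CompletelyRegularElem (a : S) : Prop :=
  ∃ x, a = a + x + a ∧ a + x = x + a ∧ a * (a + x) = a + x

/-- `S` is a quasi completely regular semiring. -/
def QuasiCompletelyRegular (S : Type*) [PSemiring S] : Prop :=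
  ∀ a : S, ∃ n : ℕ, CompletelyRegularElem (nmul n a)

/-- `S` is a completely regular semiring. -/
def CompletelyRegularSemiring (S : Type*) [PSemiring S] : Prop :=
  ∀ a : S, CompletelyRegularElem a

/-- `e` is an additive idempotent (i.e. `e ∈ E⁺(S)`). -/
def AddIdem (e : S) : Prop := e + e = e

/-- `V⁺(a)`, the set of additive inverses of `a`. -/
def Vplus (a : S) : Set S := {x | a + x + a = a ∧ x + a + x = x}

/-- `{a} ∪ (S + a)`. -/
def lset (a : S) : Set S := insert a {x | ∃ s, x = s + a}

/-- `{a} ∪ (a + S)`. -/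
def rset (a : S) : Set S := insert a {x | ∃ s, x = a + s}

/-- `{a} ∪ (S + a) ∪ (a + S) ∪ (S + a + S)`. -/
def jset (a : S) : Set S :=
  insert a ({x | ∃ s, x = s + a} ∪ {x | ∃ s, x = a + s} ∪ {x | ∃ s t, x = s + a + t})

/-- Green's relation `L⁺` on the additive reduct. -/
def GreenL (a b : S) : Prop := lset a = lset b

/-- Green's relation `R⁺` on the additive reduct. -/
def GreenR (a b : S) : Prop := rset a = rset b

/-- Green's relation `J⁺` on the additive reduct. -/
def GreenJ (a b : S) : Prop := jset a = jset b

/-- `n` is the least index such that the `(n+1)`-fold sum of `a` is additively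
regular, i.e. `(n+1)·a` is the least additively regular positive multiple. -/
def LeastReg (a : S) (n : ℕ) : Prop :=
  AddRegular (nmul n a) ∧ ∀ m < n, ¬ AddRegular (nmul m a)

/-- The relation `L*⁺`. -/
def LStar (a b : S) : Prop :=
  ∃ p q, LeastReg a p ∧ LeastReg b q ∧ GreenL (nmul p a) (nmul q b)

/-- The relation `R*⁺`. -/
def RStar (a b : S) : Prop :=
  ∃ p q, LeastReg a p ∧ LeastReg b q ∧ GreenR (nmul p a) (nmul q b)

/-- The relation `J*⁺`. -/
def JStar (a b : S) : Prop :=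
  ∃ p q, LeastReg a p ∧ LeastReg b q ∧ GreenJ (nmul p a) (nmul q b)

/-- `H*⁺ = L*⁺ ∩ R*⁺`. -/
def HStar (a b : S) : Prop := LStar a b ∧ RStar a b

/-- `D*⁺ = L*⁺ ∘ R*⁺` (relational composition). -/
def DStar (a b : S) : Prop := ∃ c, LStar a c ∧ RStar c b

/-- `z = 0_a`: `z = na + x` where `n` is the least positive integer with `na`
completely regular and `x` is the (unique) element with `na = na+x+na`,
`x = x+na+x` and `na+x = x+na`. -/
def IsZeroOf (a z : S) : Prop :=
  ∃ n x, (CompletelyRegularElem (nmul n a) ∧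
      ∀ m < n, ¬ CompletelyRegularElem (nmul m a)) ∧
    nmul n a = nmul n a + x + nmul n a ∧ x = x + nmul n a + x ∧
    nmul n a + x = x + nmul n a ∧ z = nmul n a + x

/-- The relation `𝒴`, relative to a choice `z` of the map `a ↦ 0_a`. -/
def Yrel (z : S → S) (a b : S) : Prop := Vplus (a + z a) = Vplus (b + z b)

/-- A (semiring) congruence. -/
structure IsCong (r : S → S → Prop) : Prop where
  refl : ∀ a, r a a
  symm : ∀ {a b}, r a b → r b a
  trans : ∀ {a b c}, r a b → r b c → r a c
  addl : ∀ (c : S) {a b}, r a b → r (c + a) (c + b)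
  addr : ∀ (c : S) {a b}, r a b → r (a + c) (b + c)
  mull : ∀ (c : S) {a b}, r a b → r (c * a) (c * b)
  mulr : ∀ (c : S) {a b}, r a b → r (a * c) (b * c)

/-- `r` is a b-lattice congruence: `S/r` is a b-lattice. -/
def IsBLatticeCong (r : S → S → Prop) : Prop :=
  IsCong r ∧ (∀ a : S, r (a * a) a) ∧ (∀ a : S, r (a + a) a) ∧
    ∀ a b : S, r (a + b) (b + a)

/-- `r` is the least b-lattice congruence. -/
def IsLeastBLatticeCong (r : S → S → Prop) : Prop :=
  IsBLatticeCong r ∧ ∀ r', IsBLatticeCong r' → ∀ a b, r a b → r' a b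

/-- `r` is a skew-ring congruence: `S/r` is a semiring whose additive reduct
is a group (expressed by solvability of both translation equations). -/
def IsSkewRingCong (r : S → S → Prop) : Prop :=
  IsCong r ∧ ∀ a b : S, (∃ x, r (a + x) b) ∧ ∃ y, r (y + a) b

/-- `r` is the least skew-ring congruence. -/
def IsLeastSkewRingCong (r : S → S → Prop) : Prop :=
  IsSkewRingCong r ∧ ∀ r', IsSkewRingCong r' → ∀ a b, r a b → r' a b

/-- `η` is a b-lattice-of-skew-rings congruence: `S/η` admits a congruence `ξ`
(given here as a congruence on `S` containing `η`) such that `(S/η)/ξ` is a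
b-lattice and every `ξ`-class of `S/η` is a subsemiring whose additive reduct
is a group. -/
def IsBLSRCong (η : S → S → Prop) : Prop :=
  IsCong η ∧ ∃ ξ : S → S → Prop, IsCong ξ ∧ (∀ a b, η a b → ξ a b) ∧
    (∀ a : S, ξ (a * a) a) ∧ (∀ a : S, ξ (a + a) a) ∧
    (∀ a b : S, ξ (a + b) (b + a)) ∧
    (∀ a b, ξ a b → ξ (a + b) a ∧ ξ (a * b) a) ∧
    ∀ a b, ξ a b → (∃ x, ξ x a ∧ η (a + x) b) ∧ ∃ y, ξ y a ∧ η (y + a) b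

/-- `ν` is the least b-lattice-of-skew-rings congruence. -/
def IsLeastBLSRCong (ν : S → S → Prop) : Prop :=
  IsBLSRCong ν ∧ ∀ η, IsBLSRCong η → ∀ a b, ν a b → η a b

/-- `r` is a completely regular semiring congruence: `S/r` is completely
regular. -/
def IsCRCong (r : S → S → Prop) : Prop :=
  IsCong r ∧ ∀ a : S, ∃ x, r a (a + x + a) ∧ r (a + x) (x + a) ∧
    r (a * (a + x)) (a + x)

/-- `ρ` is the least completely regular semiring congruence. -/
def IsLeastCRCong (r : S → S → Prop) : Prop :=
  IsCRCong r ∧ ∀ r', IsCRCong r' → ∀ a b, r a b → r' a b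

/-- `S` is quasi-orthodox. -/
def QuasiOrthodox (S : Type*) [PSemiring S] : Prop :=
  ∀ e f : S, AddIdem e → AddIdem f →
    ∃ n : ℕ, nmul n (e + f) = nmul (n + 1) (e + f)

/-- `S` is a completely Archimedean semiring. -/
def CompletelyArchimedean (S : Type*) [PSemiring S] : Prop :=
  QuasiCompletelyRegular S ∧ ∀ a b : S, JStar a b

/-- `r` is the least congruence containing the relation `τ`. -/
def IsLeastCongContaining (τ r : S → S → Prop) : Prop :=
  IsCong r ∧ (∀ a b, τ a b → r a b) ∧
    ∀ r', IsCong r' → (∀ a b, τ a b → r' a b) → ∀ a b, r a b → r' a b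

/-- `r` is a generalized additive idempotent pure congruence (purity part). -/
def GenAddIdemPure (r : S → S → Prop) : Prop :=
  ∀ a e : S, AddIdem e → r a e → ∃ n : ℕ, nmul n a = nmul (n + 1) a

/-- `τ^e`: `a = x + c + y`, `b = x + d + y` for some `(c,d) ∈ τ`, where each of
`x`, `y` may also be absent (i.e. `x, y ∈ S⁰`). -/
def relE (τ : S → S → Prop) (a b : S) : Prop :=
  ∃ c d, τ c d ∧ ((a = c ∧ b = d) ∨ (∃ x, a = x + c ∧ b = x + d) ∨
    (∃ y, a = c + y ∧ b = d + y) ∨ ∃ x y, a = x + c + y ∧ b = x + d + y)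

/-- `τ^♮`: the transitive closure of `(τ ∪ τ⁻¹ ∪ ε)^e`. -/
def natClosure (τ : S → S → Prop) : S → S → Prop :=
  Relation.TransGen (relE (fun a b => τ a b ∨ τ b a ∨ a = b))

end PSemiring

open PSemiring

namespace PSemiring

variable {S : Type*} [PSemiring S]

/-! ### Multiples of an element -/

theorem nmul_succ_eq_add_nmul (a : S) (n : ℕ) : nmul (n + 1) a = a + nmul n a := by
  induction n with
  | zero => rfl
  | succ n ih =>
    change nmul (n + 1) a + a = a + (nmul n a + a)
    rw [ih, add_assoc]

theorem add_nmul_comm (a : S) (n : ℕ) : a + nmul n a = nmul n a + a :=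
  (nmul_succ_eq_add_nmul a n).symm

theorem AddIdem.nmul_eq {e : S} (he : AddIdem e) (n : ℕ) : nmul n e = e := by
  induction n with
  | zero => rfl
  | succ n ih =>
    change nmul n e + e = e
    rw [ih, he]

theorem exists_nmul_add_eq_add_left (a x : S) (n : ℕ) : ∃ r, nmul n a + x = a + r := by
  cases n with
  | zero => exact ⟨x, rfl⟩
  | succ n => exact ⟨nmul n a + x, by rw [nmul_succ_eq_add_nmul, add_assoc]⟩

theorem exists_add_nmul_eq_add_right (a x : S) (n : ℕ) : ∃ r, x + nmul n a = r + a := by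
  cases n with
  | zero => exact ⟨x, rfl⟩
  | succ n => exact ⟨x + nmul n a, by rw [add_assoc]; rfl⟩

theorem exists_eq_nmul_add {a t : S} {n : ℕ} (h : nmul n a = nmul n a + nmul n a + t) (N : ℕ) :
    ∃ r, nmul n a = nmul N a + r := by
  obtain ⟨w, hw⟩ := exists_nmul_add_eq_add_left a t n
  have hstep : nmul n a = a + (nmul n a + w) := by
    rw [← add_assoc, add_nmul_comm, add_assoc, ← hw, ← add_assoc]
    exact h
  induction N with
  | zero => exact ⟨_, hstep⟩
  | succ N ih =>
    obtain ⟨r, hr⟩ := ih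
    refine ⟨r + w, ?_⟩
    rw [nmul_succ_eq_add_nmul, add_assoc, ← add_assoc (nmul N a), ← hr]
    exact hstep

theorem exists_eq_add_nmul {a t : S} {n : ℕ} (h : nmul n a = t + (nmul n a + nmul n a)) (N : ℕ) :
    ∃ r, nmul n a = r + nmul N a := by
  obtain ⟨w, hw⟩ := exists_add_nmul_eq_add_right a t n
  have hstep : nmul n a = w + nmul n a + a := by
    rw [add_assoc, ← add_nmul_comm, ← add_assoc, ← hw, add_assoc]
    exact h
  induction N with
  | zero => exact ⟨_, hstep⟩
  | succ N ih =>
    obtain ⟨r, hr⟩ := ih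
    refine ⟨w + r, ?_⟩
    change _ = w + r + (nmul N a + a)
    rw [← add_assoc, add_assoc w, ← hr]
    exact hstep

/-! ### Additive idempotents -/

theorem AddIdem.mul_left {e : S} (he : AddIdem e) (c : S) : AddIdem (c * e) := by
  rw [AddIdem, ← PSemiring.left_distrib, he]

theorem AddIdem.mul_right {e : S} (he : AddIdem e) (c : S) : AddIdem (e * c) := by
  rw [AddIdem, ← PSemiring.right_distrib, he]

theorem AddIdem.mul_self (hS : QuasiCompletelyRegular S) {e : S} (he : AddIdem e) :
    e * e = e := by
  obtain ⟨n, x, h1, h2, h3⟩ := hS e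
  rw [he.nmul_eq] at h1 h2 h3
  have h : e + x = e := by
    conv_rhs => rw [h1, add_assoc, ← h2, ← add_assoc, he]
  rwa [h] at h3

theorem AddIdem.add_add_add_add {p q : S} (hp : AddIdem p) (hq : AddIdem q)
    (hpq : AddIdem (p + q)) : p + q + (q + p) + (p + q) = p + q := by
  calc p + q + (q + p) + (p + q) = p + (q + q) + (p + p) + q := by simp only [add_assoc]
    _ = p + q + (p + q) := by rw [hp, hq]; simp only [add_assoc]
    _ = p + q := hpq

theorem AddIdem.mul_add_swap {c : S} (hc : AddIdem c) (a x : S) :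
    c * (a + x) + c * (x + a) + c * (a + x) = c * (a + x) := by
  have h := hc.mul_right (a + x)
  simp only [PSemiring.left_distrib] at h ⊢
  exact (hc.mul_right a).add_add_add_add (hc.mul_right x) h

theorem AddIdem.add_swap_mul {c : S} (hc : AddIdem c) (a x : S) :
    (a + x) * c + (x + a) * c + (a + x) * c = (a + x) * c := by
  have h := hc.mul_left (a + x)
  simp only [PSemiring.right_distrib] at h ⊢
  exact (hc.mul_left a).add_add_add_add (hc.mul_left x) h

/-! ### Stability of the additive reduct -/

theorem add_eq_idem_of_add_eq_idem (hS : QuasiCompletelyRegular S) {e t w : S}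
    (ht : t + e = t) (hew : e + w = w) (hwe : w + e = w) (htw : t + w = e) : w + t = e := by
  have hew' : ∀ n, e + nmul n w = nmul n w := by
    intro n
    induction n with
    | zero => exact hew
    | succ n ih =>
      change e + (nmul n w + w) = nmul n w + w
      rw [← add_assoc, ih]
  have hn : ∀ n, nmul n t + nmul n w = e := by
    intro n
    induction n with
    | zero => exact htw
    | succ n ih =>
      rw [nmul_succ_eq_add_nmul w]
      change nmul n t + t + (w + nmul n w) = e
      rw [add_assoc, ← add_assoc t, htw, hew', ih]
  obtain ⟨n, x, h1, h2, -⟩ := hS w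
  have hex : nmul n w + x = e := by
    have : e = e + (x + nmul n w) := by
      conv_lhs => rw [← hn n, h1]
      rw [add_assoc (nmul n w), ← add_assoc (nmul n t), hn]
    rw [← h2, ← add_assoc, hew'] at this
    exact this.symm
  obtain ⟨r, hr⟩ := exists_nmul_add_eq_add_left w x n
  have hwr : w + r = e := hr.symm.trans hex
  have htr : t = e + r := by rw [← ht, ← hwr, ← add_assoc, htw, hwr]
  rw [htr, ← add_assoc, hwe, hwr]

theorem exists_eq_add_of_eq_add_add_add_left (hS : QuasiCompletelyRegular S) {e f u v : S}
    (he : AddIdem e) (h : e = u + (f + e) + v) : ∃ s, e = s + (f + e) := by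
  have key : (e + v + e) + (e + u + f + e) = e := by
    apply add_eq_idem_of_add_eq_idem hS
    · rw [add_assoc _ e e, he]
    · rw [← add_assoc, ← add_assoc, he]
    · rw [add_assoc, he]
    · calc e + u + f + e + (e + v + e) = e + (u + (f + (e + e)) + v) + e := by
            simp only [add_assoc]
        _ = e := by rw [he, ← h, he, he]
  refine ⟨e + v + e + (e + u), ?_⟩
  conv_lhs => rw [← key]
  simp only [add_assoc]

theorem exists_eq_add_of_eq_add_add_add_right (hS : QuasiCompletelyRegular S) {e f u v : S}
    (he : AddIdem e) (h : e = u + (e + f) + v) : ∃ s, e = (e + f) + s := by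
  have key : (e + f + v + e) + (e + u + e) = e := by
    apply add_eq_idem_of_add_eq_idem hS
    · rw [add_assoc _ e e, he]
    · rw [← add_assoc, ← add_assoc, ← add_assoc, he]
    · rw [add_assoc, he]
    · calc e + u + e + (e + f + v + e) = e + (u + ((e + e) + f) + v) + e := by
            simp only [add_assoc]
        _ = e := by rw [he, ← h, he, he]
  refine ⟨v + e + (e + u + e), ?_⟩
  conv_lhs => rw [← key]
  simp only [add_assoc]

/-! ### Additively regular elements lie in subgroups -/

theorem AddRegular.exists_eq_add_add_self (hS : QuasiCompletelyRegular S) {a : S}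
    (ha : AddRegular a) : (∃ t, a = a + a + t) ∧ ∃ t, a = t + (a + a) := by
  obtain ⟨x, hx⟩ := ha
  obtain ⟨e, he'⟩ : ∃ e, e = a + x := ⟨_, rfl⟩
  obtain ⟨f, hf'⟩ : ∃ f, f = x + a := ⟨_, rfl⟩
  have he : AddIdem e := by rw [AddIdem, he', ← add_assoc, hx]
  have hf : AddIdem f := by rw [AddIdem, hf', add_assoc, ← add_assoc a, hx]
  have hee := he.mul_self hS
  have hff := hf.mul_self hS
  have h1 := he.mul_add_swap a x
  have h2 := hf.mul_add_swap a x
  have h3 := he.add_swap_mul a x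
  have h4 := hf.add_swap_mul x a
  have h5 := he.mul_add_swap x a
  have h6 := hf.mul_add_swap x a
  simp only [← he', ← hf', hee, hff] at h1 h2 h3 h4 h5 h6
  have h7 : e + f * e = e + f * e + (e * f + f) + (e + f * e) := by
    calc e + f * e = e * (e + f + e) + f * (e + f + e) := by
          simp only [PSemiring.left_distrib, hee, hff, h1, h2]
      _ = (e + f) * (e + f + e) := (PSemiring.right_distrib _ _ _).symm
      _ = _ := by
          rw [PSemiring.left_distrib, PSemiring.left_distrib]
          simp only [PSemiring.right_distrib, hee, hff]
  have h8 : e * f + f = e * f + f + (e + f * e) + (e * f + f) := by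
    calc e * f + f = e * (f + e + f) + f * (f + e + f) := by
          simp only [PSemiring.left_distrib, hee, hff, h5, h6]
      _ = (e + f) * (f + e + f) := (PSemiring.right_distrib _ _ _).symm
      _ = _ := by
          rw [PSemiring.left_distrib, PSemiring.left_distrib]
          simp only [PSemiring.right_distrib, hee, hff]
  have hea : e + a = a := by rw [he', hx]
  have haf : a + f = a := by rw [hf', ← add_assoc, hx]
  constructor
  · obtain ⟨s, hs⟩ : ∃ s, f = f + e + s := by
      apply exists_eq_add_of_eq_add_add_add_right hS (u := f + e * f) (v := f * e + (e * f + f)) hf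
      conv_lhs => rw [← h4, add_assoc, h8]
      simp only [add_assoc]
    refine ⟨x + s, ?_⟩
    calc a = a + (f + e + s) := by rw [← hs, haf]
      _ = a + f + (a + x + s) := by rw [he']; simp only [add_assoc]
      _ = _ := by rw [haf]; simp only [add_assoc]
  · obtain ⟨s, hs⟩ : ∃ s, e = s + (f + e) := by
      apply exists_eq_add_of_eq_add_add_add_left hS (u := e + f * e + e * f) (v := f * e + e) he
      conv_lhs => rw [← h3, h7]
      simp only [add_assoc]
    refine ⟨s + x, ?_⟩
    calc a = (s + (f + e)) + a := by rw [← hs, hea]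
      _ = s + (x + a) + (e + a) := by rw [hf']; simp only [add_assoc]
      _ = _ := by rw [hea]; simp only [add_assoc]

/-! ### The idempotent `0_a` and the relations `R*⁺`, `L*⁺` -/

theorem IsZeroOf.addIdem {a z : S} (h : IsZeroOf a z) : AddIdem z := by
  obtain ⟨n, x, -, h1, -, -, rfl⟩ := h
  rw [AddIdem, ← add_assoc, ← h1]

theorem IsZeroOf.add_comm {a z : S} (h : IsZeroOf a z) : z + a = a + z := by
  obtain ⟨n, x, -, h1, -, h3, rfl⟩ := h
  have hl : nmul n a + x + (a + (nmul n a + x)) = a + (nmul n a + x) := by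
    rw [← add_assoc a, add_nmul_comm]
    simp only [← add_assoc]
    rw [← h1]
  have hr : nmul n a + x + a + (nmul n a + x) = nmul n a + x + a := by
    rw [h3, add_assoc x, ← add_nmul_comm]
    calc x + (a + nmul n a) + (x + nmul n a) = x + (a + (nmul n a + x + nmul n a)) := by
          simp only [add_assoc]
      _ = _ := by rw [← h1]
  rw [← hr, ← hl]
  simp only [add_assoc]

theorem IsZeroOf.exists_inverse {a z : S} (h : IsZeroOf a z) :
    ∃ y, a + z + y = z ∧ y + (a + z) = z := by
  have hz := h.addIdem
  have hc := h.add_comm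
  obtain ⟨n, x, -, -, -, h3, hzx⟩ := h
  obtain ⟨r, hr⟩ := exists_nmul_add_eq_add_left a x n
  obtain ⟨l, hl⟩ := exists_add_nmul_eq_add_right a x n
  rw [← hzx] at hr
  rw [← h3, ← hzx] at hl
  have hR : a + z + (r + z) = z := by
    rw [← hc, ← add_assoc, add_assoc z, ← hr, hz, hz]
  have hL : z + l + (a + z) = z := by
    rw [← add_assoc, add_assoc z, ← hl, hz, hz]
  have hzz : z + (a + z) = a + z := by rw [← add_assoc, hc, add_assoc, hz]
  have hLR : z + l + z = z + (r + z) := by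
    calc z + l + z = z + l + (a + z + (r + z)) := by rw [hR]
      _ = z + l + (a + z) + (r + z) := by simp only [add_assoc]
      _ = _ := by rw [hL]
  refine ⟨z + l + z, ?_, ?_⟩
  · rw [hLR, ← add_assoc, add_assoc a, hz, hR]
  · rw [add_assoc, hzz, hL]

theorem rset_eq_rset {c d s t : S} (h : c = d + s) (h' : d = c + t) : rset c = rset d := by
  have aux : ∀ {c d s : S}, c = d + s → rset c ⊆ rset d := by
    rintro c d s rfl y (rfl | ⟨r, rfl⟩)
    · exact Or.inr ⟨s, rfl⟩
    · exact Or.inr ⟨s + r, add_assoc _ _ _⟩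
  exact (aux h).antisymm (aux h')

theorem lset_eq_lset {c d s t : S} (h : c = s + d) (h' : d = t + c) : lset c = lset d := by
  have aux : ∀ {c d s : S}, c = s + d → lset c ⊆ lset d := by
    rintro c d s rfl y (rfl | ⟨r, rfl⟩)
    · exact Or.inr ⟨s, rfl⟩
    · exact Or.inr ⟨r + s, (add_assoc _ _ _).symm⟩
  exact (aux h).antisymm (aux h')

theorem AddIdem.addRegular {e : S} (he : AddIdem e) : AddRegular e := ⟨e, by rw [he, he]⟩

theorem AddIdem.leastReg_zero {e : S} (he : AddIdem e) : LeastReg e 0 :=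
  ⟨he.addRegular, fun _ h => absurd h (Nat.not_lt_zero _)⟩

theorem AddIdem.eq_zero_of_leastReg {e : S} (he : AddIdem e) {n : ℕ} (h : LeastReg e n) :
    n = 0 :=
  Nat.eq_zero_of_not_pos fun hn => h.2 0 hn he.addRegular

theorem exists_leastReg (hS : QuasiCompletelyRegular S) (a : S) : ∃ n, LeastReg a n := by
  classical
  have h : ∃ n, AddRegular (nmul n a) := by
    obtain ⟨n, x, hx, -⟩ := hS a
    exact ⟨n, x, hx.symm⟩
  exact ⟨Nat.find h, Nat.find_spec h, fun _ hm => Nat.find_min h hm⟩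

theorem IsZeroOf.regular_multiple_right (hS : QuasiCompletelyRegular S) {a z : S}
    (h : IsZeroOf a z) {q : ℕ} (hq : AddRegular (nmul q a)) :
    z + nmul q a = nmul q a ∧ ∃ s, z = nmul q a + s := by
  obtain ⟨n, x, -, h1, -, h3, rfl⟩ := h
  obtain ⟨t, ht⟩ := (hq.exists_eq_add_add_self hS).1
  obtain ⟨r, hr⟩ := exists_eq_nmul_add ht n
  obtain ⟨r', hr'⟩ := exists_eq_nmul_add (a := a) (n := n) (t := x)
    (by rw [add_assoc, h3, ← add_assoc]; exact h1) q
  constructor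
  · rw [hr, ← add_assoc, ← h1]
  · refine ⟨r' + x, ?_⟩
    rw [← add_assoc, ← hr']

theorem IsZeroOf.regular_multiple_left (hS : QuasiCompletelyRegular S) {a z : S}
    (h : IsZeroOf a z) {q : ℕ} (hq : AddRegular (nmul q a)) :
    nmul q a + z = nmul q a ∧ ∃ s, z = s + nmul q a := by
  obtain ⟨n, x, -, h1, -, h3, rfl⟩ := h
  obtain ⟨t, ht⟩ := (hq.exists_eq_add_add_self hS).2
  obtain ⟨r, hr⟩ := exists_eq_add_nmul ht n
  obtain ⟨r', hr'⟩ := exists_eq_add_nmul (a := a) (n := n) (t := x)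
    (by rw [← add_assoc, ← h3]; exact h1) q
  constructor
  · rw [hr, add_assoc, h3, ← add_assoc (nmul n a), ← h1]
  · refine ⟨x + r', ?_⟩
    rw [add_assoc, ← hr', h3]

theorem IsZeroOf.rStar_iff (hS : QuasiCompletelyRegular S) {a z e : S} (h : IsZeroOf a z)
    (he : AddIdem e) : RStar e a ↔ e + z = z ∧ z + e = e := by
  constructor
  · rintro ⟨p, q, hp, hq, hpq⟩
    obtain rfl := he.eq_zero_of_leastReg hp
    obtain ⟨hz, s, hs⟩ := h.regular_multiple_right hS hq.1
    change rset e = rset (nmul q a) at hpq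
    have h1 : e ∈ rset (nmul q a) := hpq ▸ Or.inl rfl
    have h2 : nmul q a ∈ rset e := hpq ▸ Or.inl rfl
    have h3 : e + nmul q a = nmul q a := by
      obtain h2 | ⟨t, ht⟩ := h2
      · rw [h2, he]
      · rw [ht, ← add_assoc, he]
    constructor
    · rw [hs, ← add_assoc, h3]
    · obtain h1 | ⟨t, ht⟩ := h1
      · rw [h1, hz]
      · rw [ht, ← add_assoc, hz]
  · rintro ⟨h1, h2⟩
    obtain ⟨q, hq⟩ := exists_leastReg hS a
    obtain ⟨hz, s, hs⟩ := h.regular_multiple_right hS hq.1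
    refine ⟨0, q, he.leastReg_zero, hq, rset_eq_rset (s := s + e) (t := nmul q a) ?_ ?_⟩
    · rw [← add_assoc, ← hs, h2]; rfl
    · change _ = e + nmul q a
      conv_rhs => rw [← hz, ← add_assoc, h1, hz]

theorem IsZeroOf.lStar_iff (hS : QuasiCompletelyRegular S) {a z f : S} (h : IsZeroOf a z)
    (hf : AddIdem f) : LStar a f ↔ z + f = z ∧ f + z = f := by
  constructor
  · rintro ⟨q, p, hq, hp, hpq⟩
    obtain rfl := hf.eq_zero_of_leastReg hp
    obtain ⟨hz, s, hs⟩ := h.regular_multiple_left hS hq.1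
    change lset (nmul q a) = lset f at hpq
    have h1 : f ∈ lset (nmul q a) := hpq ▸ Or.inl rfl
    have h2 : nmul q a ∈ lset f := hpq ▸ Or.inl rfl
    have h3 : nmul q a + f = nmul q a := by
      obtain h2 | ⟨t, ht⟩ := h2
      · rw [h2, hf]
      · rw [ht, add_assoc, hf]
    constructor
    · rw [hs, add_assoc, h3]
    · obtain h1 | ⟨t, ht⟩ := h1
      · rw [h1, hz]
      · rw [ht, add_assoc, hz]
  · rintro ⟨h1, h2⟩
    obtain ⟨q, hq⟩ := exists_leastReg hS a
    obtain ⟨hz, s, hs⟩ := h.regular_multiple_left hS hq.1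
    refine ⟨q, 0, hq, hf.leastReg_zero, lset_eq_lset (s := nmul q a) (t := f + s) ?_ ?_⟩
    · change _ = nmul q a + f
      conv_rhs => rw [← hz, add_assoc, h1, hz]
    · rw [add_assoc, ← hs, h2]; rfl

/-! ### Additive inverses of `a + 0_a` -/

theorem IsZeroOf.eq_add_add_of_vplus_subset {a z e f B : S} (h : IsZeroOf a z)
    (he : e + z = z ∧ z + e = e) (hf : z + f = z ∧ f + z = f)
    (hV : Vplus (a + z) ⊆ Vplus B) : a + z = e + B + f := by
  obtain ⟨y, hy1, hy2⟩ := h.exists_inverse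
  have hAz : a + z + z = a + z := by rw [add_assoc, h.addIdem]
  have hzA : z + (a + z) = a + z := by rw [← add_assoc, h.add_comm, hAz]
  have hAf : a + z + f = a + z := by rw [add_assoc, hf.1]
  have heA : e + (a + z) = a + z := by rw [← hzA, ← add_assoc, he.1]
  have hAx : a + z + (f + y + e) = e := by
    rw [← add_assoc, ← add_assoc, hAf, hy1, he.2]
  have hxA : f + y + e + (a + z) = f := by
    rw [add_assoc, heA, add_assoc, hy2, hf.2]
  have hff : f + f = f := by
    calc f + f = f + z + f := by rw [hf.2]
      _ = f := by rw [add_assoc, hf.1, hf.2]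
  have hx : f + y + e ∈ Vplus (a + z) := by
    refine ⟨by rw [hAx, heA], ?_⟩
    rw [hxA, ← add_assoc, ← add_assoc, hff]
  have hB := (hV hx).2
  calc a + z = e + (a + z) := heA.symm
    _ = a + z + (f + y + e + B + (f + y + e)) + (a + z) := by rw [hB, hAx]
    _ = a + z + (f + y + e) + B + (f + y + e + (a + z)) := by simp only [add_assoc]
    _ = e + B + f := by rw [hAx, hxA]

theorem IsZeroOf.vplus_subset (hS : QuasiCompletelyRegular S) {a b z w : S}
    (ha : IsZeroOf a z) (hb : IsZeroOf b w)
    (hA : ∀ e f : S, AddIdem e → AddIdem f → RStar e a → LStar a f →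
      a + z = e + (b + w) + f)
    (hB : b + w = w + (a + z) + w) : Vplus (a + z) ⊆ Vplus (b + w) := by
  rintro x ⟨hx1, hx2⟩
  obtain ⟨y, hy1, hy2⟩ := ha.exists_inverse
  obtain ⟨y', hy1', -⟩ := hb.exists_inverse
  have hAz : a + z + z = a + z := by rw [add_assoc, ha.addIdem]
  have hzA : z + (a + z) = a + z := by rw [← add_assoc, ha.add_comm, hAz]
  have hBw : b + w + w = b + w := by rw [add_assoc, hb.addIdem]
  have hwB : w + (b + w) = b + w := by rw [← add_assoc, hb.add_comm, hBw]
  generalize a + z = A at *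
  generalize b + w = B at *
  have he : AddIdem (A + x) := by rw [AddIdem, ← add_assoc, hx1]
  have hf : AddIdem (x + A) := by rw [AddIdem, ← add_assoc, hx2]
  have hA' := hA _ _ he hf
    ((ha.rStar_iff hS he).2 ⟨by rw [← hy1, ← add_assoc, hx1], by rw [← add_assoc, hzA]⟩)
    ((ha.lStar_iff hS hf).2 ⟨by rw [← hy2, add_assoc, ← add_assoc A, hx1],
      by rw [add_assoc, hAz]⟩)
  have hxBx : x + B + x = x := by
    calc x + B + x = x + A + x + B + (x + A + x) := by rw [hx2]
      _ = x + (A + x + B + (x + A)) + x := by simp only [add_assoc]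
      _ = x := by rw [← hA', hx2]
  refine ⟨?_, hxBx⟩
  obtain ⟨s, hs⟩ : ∃ s, w = w + (B + x) + s := by
    apply exists_eq_add_of_eq_add_add_add_right hS (u := w + A + x) (v := A + w + y') hb.addIdem
    have : w + (B + x) = B + x := by rw [← add_assoc, hwB]
    calc w = B + y' := hy1'.symm
      _ = w + (A + (x + B + x) + A) + w + y' := by rw [hxBx, hx1, ← hB]
      _ = _ := by rw [this]; simp only [add_assoc]
  rw [← add_assoc, hwB] at hs
  have hBxw : B + x + w = w := by
    calc B + x + w = B + x + (B + x + s) := by rw [← hs]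
      _ = B + (x + B + x) + s := by simp only [add_assoc]
      _ = w := by rw [hxBx, ← hs]
  calc B + x + B = B + x + w + B := by rw [add_assoc _ w, hwB]
    _ = B := by rw [hBxw, hwB]

end PSemiring

/-- In a quasi completely regular semiring with least b-lattice
congruence `ξ`, for `a, b` in the same `ξ`-class: `a 𝒴 b` iff for all additive
idempotents `e, f, g, h` with `e R*⁺ a`, `a L*⁺ f`, `g R*⁺ b`, `b L*⁺ h` one
has `a+0_a = e+b+0_b+f` and `b+0_b = g+a+0_a+h`. -/
theorem yrel_iff_idem_translations {S : Type*} [PSemiring S]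
    (hS : QuasiCompletelyRegular S) (z : S → S) (hz : ∀ a, IsZeroOf a (z a))
    (ξ : S → S → Prop) (hξ : IsLeastBLatticeCong ξ)
    (a b : S) (hab : ξ a b) :
    Yrel z a b ↔
      ∀ e f g h : S, AddIdem e → AddIdem f → AddIdem g → AddIdem h →
        RStar e a → LStar a f → RStar g b → LStar b h →
        a + z a = e + b + z b + f ∧ b + z b = g + a + z a + h := by
  constructor
  · intro hY e f g h he hf hg hh hea haf hgb hbh
    rw [add_assoc e, add_assoc g]
    exact ⟨(hz a).eq_add_add_of_vplus_subset (((hz a).rStar_iff hS he).1 hea)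
        (((hz a).lStar_iff hS hf).1 haf) hY.subset,
      (hz b).eq_add_add_of_vplus_subset (((hz b).rStar_iff hS hg).1 hgb)
        (((hz b).lStar_iff hS hh).1 hbh) hY.superset⟩
  · intro H
    have ia := (hz a).addIdem
    have ib := (hz b).addIdem
    have ra := ((hz a).rStar_iff hS ia).2 ⟨ia, ia⟩
    have la := ((hz a).lStar_iff hS ia).2 ⟨ia, ia⟩
    have rb := ((hz b).rStar_iff hS ib).2 ⟨ib, ib⟩
    have lb := ((hz b).lStar_iff hS ib).2 ⟨ib, ib⟩
    have H0 := H _ _ _ _ ia ia ib ib ra la rb lb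
    rw [add_assoc (z a), add_assoc (z b)] at H0
    apply Set.Subset.antisymm
    · refine (hz a).vplus_subset hS (hz b) (fun e f he hf hea haf => ?_) H0.2
      rw [← add_assoc e]
      exact (H e f _ _ he hf ib ib hea haf rb lb).1
    · refine (hz b).vplus_subset hS (hz a) (fun g h hg hh hgb hbh => ?_) H0.1
      rw [← add_assoc g]
      exact (H _ _ g h ia ia hg hh ra la hgb hbh).2
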